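/- For all integers k >= 2 and e >= 3, there exists an integer n_0 ≡ 0 (mod 2e) such that for every n >= n_0 with n ≡ 0 or 1 (mod 2e), there exists a uniquely k-chromatic e-star system of order n. -/

import Mathlib

structure EStar (n e : ℕ) where
  centre : Fin n
  leaves : Finset (Fin n)
  card_leaves : leaves.card = e
  centre_not_leaf : centre ∉ leaves

instance {n e : ℕ} : DecidableEq (EStar n e) := fun a b =>
  decidable_of_iff (a.centre = b.centre ∧ a.leaves = b.leaves)
    (by cases a; cases b; simp)

/-- The edge set of an `e`-star: all edges joining the centre to a leaf. -/
def EStar.edges {n e : ℕ} (S : EStar n e) : Finset (Sym2 (Fin n)) :=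
  S.leaves.image (fun a => s(S.centre, a))

/-- The vertex set of an `e`-star. -/
def EStar.verts {n e : ℕ} (S : EStar n e) : Finset (Fin n) :=
  insert S.centre S.leaves

/-- An `e`-star system of order `n`: a collection of `e`-stars whose edge sets
partition the edge set of the complete graph `K_n`. -/
structure EStarSystem (n e : ℕ) where
  stars : Finset (EStar n e)
  partition : ∀ p : Sym2 (Fin n), ¬ p.IsDiag →
    ∃! S, S ∈ stars ∧ p ∈ EStar.edges S

/-- A weak colouring: no star of the system has all of its vertices one colour. -/
def IsWeakColouring {n e k : ℕ} (sys : EStarSystem n e) (c : Fin n → Fin k) : Prop :=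
  ∀ S ∈ sys.stars, ∃ a ∈ S.leaves, c a ≠ c S.centre

def Colourable {n e : ℕ} (sys : EStarSystem n e) (k : ℕ) : Prop :=
  ∃ c : Fin n → Fin k, IsWeakColouring sys c

def Chromatic {n e : ℕ} (sys : EStarSystem n e) (k : ℕ) : Prop :=
  Colourable sys k ∧ ¬ Colourable sys (k - 1)

/-- The size of the colour class of colour `i`. -/
def classCard {n k : ℕ} (c : Fin n → Fin k) (i : Fin k) : ℕ :=
  (Finset.univ.filter (fun v => c v = i)).card

def UniquelyColourable {n e : ℕ} (sys : EStarSystem n e) (k : ℕ) : Prop :=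
  ∀ c₁ c₂ : Fin n → Fin k, IsWeakColouring sys c₁ → IsWeakColouring sys c₂ →
    ∃ π : Equiv.Perm (Fin k), c₂ = π ∘ c₁

open Function

/-- The family of stars with centres `ctr i` and leaves `leaf i a` is edge-disjoint. -/
def IsPacking {V ι : Type} {e : ℕ} (ctr : ι → V) (leaf : ι → Fin e → V) : Prop :=
  (∀ i a, ctr i ≠ leaf i a) ∧ Injective fun p : ι × Fin e => s(ctr p.1, leaf p.1 p.2)

/-- No star of the family is monochromatic under `c`. -/
def IsProper {V ι K : Type} {e : ℕ} (ctr : ι → V) (leaf : ι → Fin e → V) (c : V → K) : Prop :=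
  ∀ i, ∃ a, c (leaf i a) ≠ c (ctr i)

/-- There are finite packings of stars that are not weakly `k`-colourable. -/
theorem exists_packing_not_colourable (e k : ℕ) :
    ∃ (V ι : Type) (_ : Finite V) (_ : Finite ι) (ctr : ι → V) (leaf : ι → Fin e → V),
      IsPacking ctr leaf ∧ ∀ c : V → Fin k, ¬ IsProper ctr leaf c := by
  induction k with
  | zero =>
    exact ⟨Unit, Empty, inferInstance, inferInstance, Empty.elim, fun i => i.elim,
      ⟨fun i => i.elim, fun p => p.1.elim⟩, fun c => (c ()).elim0⟩
  | succ k ih =>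
    obtain ⟨V, ι, _, _, ctr, leaf, ⟨hne, hinj⟩, hc⟩ := ih
    refine ⟨(Fin (k + 1) × Fin e × V) ⊕ (Fin (k + 1) → Fin e → V),
      (Fin (k + 1) × Fin e × ι) ⊕ ((Fin (k + 1) → Fin e → V) × Fin (k + 1)),
      inferInstance, inferInstance,
      Sum.elim (fun p => .inl (p.1, p.2.1, ctr p.2.2)) (fun p => .inr p.1),
      Sum.elim (fun p a => .inl (p.1, p.2.1, leaf p.2.2 a)) (fun p a => .inl (p.2, a, p.1 p.2 a)),
      ⟨?_, ?_⟩, ?_⟩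
    · rintro (⟨g, b, i⟩ | ⟨F, g⟩) a
      · simpa using hne i a
      · simp
    · rintro ⟨⟨g, b, i⟩ | ⟨F, g⟩, a⟩ ⟨⟨g', b', i'⟩ | ⟨F', g'⟩, a'⟩ h
      · have := @hinj (i, a) (i', a')
        simp only [Sum.elim_inl, Sym2.eq_iff, Sum.inl.injEq, Prod.mk.injEq] at h this ⊢
        tauto
      · simp at h
      · simp at h
      · simp only [Sum.elim_inr, Sym2.eq_iff, Sum.inl.injEq, Sum.inr.injEq, Prod.mk.injEq,
          reduceCtorEq, false_and, or_false] at h ⊢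
        tauto
    · intro c hcp
      have key : ∀ (g : Fin (k + 1)) (b : Fin e), ∃ v, c (.inl (g, b, v)) = g := by
        intro g b
        by_contra! hg
        choose c' hc' using fun v => Fin.exists_succAbove_eq (hg v)
        refine hc c' fun i => ?_
        obtain ⟨a, ha⟩ := hcp (.inl (g, b, i))
        refine ⟨a, fun h => ha ?_⟩
        simp only [Sum.elim_inl, ← hc', h]
      choose F hF using key
      obtain ⟨a, ha⟩ := hcp (.inr (F, c (.inr F)))
      exact ha (hF _ _)

/-- There is a weakly `k`-colourable packing with `e` distinct vertices which have the same colour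
in every weak `k`-colouring. -/
theorem exists_packing_forcing_mono (e : ℕ) {k : ℕ} (hk : 1 ≤ k) :
    ∃ (V ι : Type) (_ : Finite V) (_ : Finite ι) (ctr : ι → V) (leaf : ι → Fin e → V)
      (s : Fin e → V) (c₀ : V → Fin k),
      IsPacking ctr leaf ∧ Injective s ∧ IsProper ctr leaf c₀ ∧
        ∀ c : V → Fin k, IsProper ctr leaf c → ∀ a b, c (s a) = c (s b) := by
  obtain ⟨V, ι, _, _, ctr, leaf, ⟨hne, hinj⟩, hc⟩ := exists_packing_not_colourable e k
  let Bad : Set (Set ι) := {I | ∀ c : V → Fin k, ∃ i ∈ I, ∀ a, c (leaf i a) = c (ctr i)}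
  have hBad : Bad.Nonempty := by
    refine ⟨Set.univ, fun c => ?_⟩
    have := hc c
    simp only [IsProper] at this
    push Not at this
    simpa using this
  obtain ⟨I, hI⟩ := (Set.toFinite Bad).exists_minimal hBad
  obtain ⟨i₀, hi₀, -⟩ := hI.1 fun _ => ⟨0, hk⟩
  have hnot : I \ {i₀} ∉ Bad := fun h => (hI.2 h Set.sdiff_subset hi₀).2 rfl
  simp only [Bad, Set.mem_ofPred_eq] at hnot
  push Not at hnot
  obtain ⟨c₀, hc₀⟩ := hnot
  refine ⟨V, ↥(I \ {i₀}), inferInstance, inferInstance, fun i => ctr i, fun i => leaf i,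
    leaf i₀, c₀, ⟨fun i a => hne i a, ?_⟩, ?_, fun i => hc₀ i i.2, ?_⟩
  · rintro ⟨⟨i, hi⟩, a⟩ ⟨⟨j, hj⟩, b⟩ h
    have := @hinj (i, a) (j, b) h
    simpa using this
  · intro a b h
    have := @hinj (i₀, a) (i₀, b) (by simp [h])
    simpa using this
  · intro c hcp
    obtain ⟨i, hi, him⟩ := hI.1 c
    by_cases hii : i = i₀
    · subst hii
      intro a b
      rw [him, him]
    · obtain ⟨a, ha⟩ := hcp ⟨i, hi, hii⟩
      exact absurd (him a) ha

/-- For all large `N` there is a packing on `N` vertices with exactly one weak `k`-colouring up to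
permutations of the colours, and with more than `e` vertices of each colour. -/
theorem exists_uniquely_colourable_packing {e k : ℕ} (he : 1 ≤ e) (hk : 1 ≤ k) :
    ∃ N₀ : ℕ, ∀ N, N₀ ≤ N →
    ∃ (V ι : Type) (_ : Fintype V) (_ : Fintype ι) (ctr : ι → V) (leaf : ι → Fin e → V)
      (c₀ : V → Fin k) (emb : Fin k → Fin (e + 1) → V),
      Fintype.card V = N ∧ IsPacking ctr leaf ∧ IsProper ctr leaf c₀ ∧
      (∀ c : V → Fin k, IsProper ctr leaf c → ∃ π : Equiv.Perm (Fin k), c = π ∘ c₀) ∧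
      (∀ i, Injective (emb i)) ∧ ∀ i a, c₀ (emb i a) = i := by
  classical
  obtain ⟨G, ι, _, _, ctr, leaf, s, cG, ⟨hne, hinj⟩, hs, hcG, hmono⟩ :=
    exists_packing_forcing_mono e hk
  have := Fintype.ofFinite G
  have := Fintype.ofFinite ι
  let a₀ : Fin e := ⟨0, he⟩
  refine ⟨Fintype.card (G × Fin k) + Fintype.card (Fin k × Fin (e + 1)), fun N hN => ?_⟩
  obtain ⟨r, rfl⟩ := Nat.exists_eq_add_of_le hN
  let U := Fin k × Fin (e + 1) ⊕ Fin r
  let col : U → Fin k := Sum.elim Prod.fst fun _ => ⟨0, hk⟩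
  let cQ : G × Fin k → Fin k := fun v => Equiv.swap (cG (s a₀)) v.2 (cG v.1)
  have hcQ : ∀ a i, cQ (s a, i) = i := fun a i => by
    simp only [cQ, hmono cG hcG a a₀, Equiv.swap_apply_left]
  let emb : Fin k → Fin (e + 1) → U := fun i a => .inl (i, a)
  let J₁ := {p : Fin k × Fin k // p.1 < p.2}
  let J₂ := {p : U × Fin k // p.2 ≠ col p.1}
  let J₃ := {p : (G × Fin k) × Fin k // p.2 ≠ cQ p.1 ∧ p.1.1 ∉ Set.range s}
  let ctr' : (ι × Fin k ⊕ J₁) ⊕ (J₂ ⊕ J₃) → (G × Fin k) ⊕ U :=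
    Sum.elim (Sum.elim (fun p => .inl (ctr p.1, p.2)) fun p => .inl (s a₀, p.1.2))
      (Sum.elim (fun p => .inr p.1.1) fun p => .inl p.1.1)
  let leaf' : (ι × Fin k ⊕ J₁) ⊕ (J₂ ⊕ J₃) → Fin e → (G × Fin k) ⊕ U :=
    Sum.elim (Sum.elim (fun p a => .inl (leaf p.1 a, p.2)) fun p a => .inl (s a, p.1.1))
      (Sum.elim (fun p a => .inl (s a, p.1.2)) fun p a => .inr (emb p.1.2 a.castSucc))
  refine ⟨(G × Fin k) ⊕ U, (ι × Fin k ⊕ J₁) ⊕ (J₂ ⊕ J₃), inferInstance, inferInstance,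
    ctr', leaf', Sum.elim cQ col, fun i a => .inr (emb i a), ?_, ⟨?_, ?_⟩, ?_, ?_, ?_, ?_⟩
  · simp [U, add_assoc]
  · rintro ((⟨i, x⟩ | ⟨⟨x, y⟩, hxy⟩) | (⟨⟨u, i⟩, h⟩ | ⟨⟨v, i⟩, h⟩)) a
    · simpa [ctr', leaf'] using hne i a
    · simpa [ctr', leaf'] using fun _ => hxy.ne'
    · simp [ctr', leaf']
    · simp [ctr', leaf']
  · rintro ⟨(⟨i, x⟩ | ⟨⟨x, y⟩, hxy⟩) | (⟨⟨u, i⟩, h⟩ | ⟨⟨⟨v, w⟩, i⟩, h, hv⟩), a⟩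
      ⟨(⟨i', x'⟩ | ⟨⟨x', y'⟩, hxy'⟩) | (⟨⟨u', i'⟩, h'⟩ | ⟨⟨⟨v', w'⟩, i'⟩, h', hv'⟩), a'⟩ heq <;>
    simp [ctr', leaf', hs.eq_iff, emb] at heq ⊢
    · have := @hinj (i, a) (i', a')
      simp only [Sym2.eq_iff, Prod.mk.injEq] at this
      tauto
    · simp only at hxy'
      omega
    · simp only at hxy
      omega
    · simp only at hxy hxy'
      have hne : ¬ (y = x' ∧ x = y') := by omega
      simp only [J₁, Subtype.mk.injEq, Prod.mk.injEq]
      tauto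
    · simp only [J₂, Subtype.mk.injEq, Prod.mk.injEq]
      tauto
    · exact hv' ⟨a, heq.2.1⟩
    · exact hv ⟨a', heq.1.1.symm⟩
    · have hia := Prod.mk.inj (Sum.inl_injective heq.2)
      simp only [J₃, Subtype.mk.injEq, Prod.mk.injEq]
      exact ⟨⟨heq.1, hia.1⟩, Fin.castSucc_injective _ hia.2⟩
  · rintro ((⟨i, x⟩ | ⟨⟨x, y⟩, hxy⟩) | (⟨⟨u, i⟩, h⟩ | ⟨⟨v, i⟩, h⟩))
    · obtain ⟨a, ha⟩ := hcG i
      exact ⟨a, by simpa [ctr', leaf', cQ] using ha⟩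
    · exact ⟨a₀, by simpa [ctr', leaf', hcQ] using hxy.ne⟩
    · exact ⟨a₀, by simpa [ctr', leaf', hcQ] using h⟩
    · exact ⟨a₀, by simpa [ctr', leaf', col, emb] using h.1⟩
  · intro c hc
    have hm : ∀ i a, c (.inl (s a, i)) = c (.inl (s a₀, i)) := fun i a =>
      hmono (fun v => c (.inl (v, i))) (fun j => hc (.inl (.inl (j, i)))) a a₀
    have hlt : ∀ x y, x < y → c (.inl (s a₀, x)) ≠ c (.inl (s a₀, y)) := fun x y hxy => by
      obtain ⟨a, ha⟩ := hc (.inl (.inr ⟨(x, y), hxy⟩))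
      simpa [ctr', leaf', hm x a] using ha
    have hμ : Injective fun i => c (.inl (s a₀, i)) := fun x y hxy => by
      rcases lt_trichotomy x y with h | h | h
      · exact absurd hxy (hlt _ _ h)
      · exact h
      · exact absurd hxy.symm (hlt _ _ h)
    let π := Equiv.ofBijective _ (Finite.injective_iff_bijective.1 hμ)
    have hπ : ∀ i, c (.inl (s a₀, i)) = π i := fun i => rfl
    have hforce : ∀ (x j : Fin k), (∀ i, i ≠ j → π i ≠ x) → x = π j := fun x j h => by
      by_contra hx
      refine h (π.symm x) (fun h' => hx ?_) (π.apply_symm_apply x)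
      rw [← h', π.apply_symm_apply]
    have hU : ∀ u, c (.inr u) = π (col u) := fun u => hforce _ _ fun i hi => by
      obtain ⟨a, ha⟩ := hc (.inr (.inl ⟨(u, i), hi⟩))
      simpa [ctr', leaf', hm i a, hπ] using ha
    refine ⟨π, funext ?_⟩
    rintro (⟨v, i⟩ | u)
    · by_cases hv : v ∈ Set.range s
      · obtain ⟨a, rfl⟩ := hv
        simp [hm i a, hπ, hcQ]
      · refine hforce _ _ fun j hj => ?_
        obtain ⟨a, ha⟩ := hc (.inr (.inr ⟨((v, i), j), hj, hv⟩))
        simpa [ctr', leaf', hU, col, emb] using ha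
    · exact hU u
  · intro i a b h
    exact (Prod.mk.inj (Sum.inl_injective (Sum.inr_injective h))).2
  · intro i a
    simp [emb, col]

/-- A packing of stars covering all edges of the complete graph gives an `e`-star system. -/
theorem exists_system_of_packing {V ι : Type} [Fintype ι] {n e : ℕ} (ψ : V ≃ Fin n) {ctr : ι → V}
    {leaf : ι → Fin e → V} (hp : IsPacking ctr leaf)
    (hcov : ∀ u v, u ≠ v → ∃ i a, s(ctr i, leaf i a) = s(u, v)) :
    ∃ sys : EStarSystem n e, ∀ (k : ℕ) (c : Fin n → Fin k),
      IsWeakColouring sys c ↔ IsProper ctr leaf (c ∘ ψ) := by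
  obtain ⟨hne, hinj⟩ := hp
  have hleaf : ∀ i, Injective (ψ ∘ leaf i) := fun i => ψ.injective.comp fun a b h => by
    have := @hinj (i, a) (i, b) (by simp [h])
    simpa using this
  let star : ι → EStar n e := fun i =>
    ⟨ψ (ctr i), Finset.univ.image (ψ ∘ leaf i), by
      rw [Finset.card_image_of_injective _ (hleaf i)]; simp, by
      simpa using fun a h => hne i a h.symm⟩
  have hmem : ∀ i p, p ∈ (star i).edges ↔ ∃ a, Sym2.map ψ s(ctr i, leaf i a) = p := by
    intro i p
    simp [star, EStar.edges]
  refine ⟨⟨Finset.univ.image star, ?_⟩, fun k c => ?_⟩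
  · intro p hpd
    obtain ⟨p', rfl⟩ : ∃ p', Sym2.map ψ p' = p :=
      ⟨Sym2.map ψ.symm p, by simp [Sym2.map_map]⟩
    induction p' using Sym2.ind with
    | _ u v =>
      obtain ⟨i, a, hia⟩ := hcov u v (by rintro rfl; simp at hpd)
      refine ⟨star i, ⟨by simp, (hmem _ _).2 ⟨a, by rw [hia]⟩⟩, ?_⟩
      rintro S ⟨hS, hpS⟩
      obtain ⟨j, -, rfl⟩ := Finset.mem_image.1 hS
      obtain ⟨b, hb⟩ := (hmem _ _).1 hpS
      have := @hinj (j, b) (i, a) ((Sym2.map.injective ψ.injective hb).trans hia.symm)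
      rw [(Prod.mk.inj this).1]
  · simp [IsWeakColouring, IsProper, star]

/-- The edges outside a packing can be enumerated. -/
theorem exists_enum_uncovered {C ι : Type} [Fintype C] [Fintype ι] {e : ℕ} {ctr : ι → C}
    {leaf : ι → Fin e → C} (hp : IsPacking ctr leaf) :
    ∃ (q : ℕ) (src tgt : Fin q → C),
      q + Fintype.card ι * e = (Fintype.card C).choose 2 ∧ (∀ p, src p ≠ tgt p) ∧
      (Injective fun p => s(src p, tgt p)) ∧
      (∀ i a p, s(ctr i, leaf i a) ≠ s(src p, tgt p)) ∧
      ∀ u v, u ≠ v → (∃ i a, s(ctr i, leaf i a) = s(u, v)) ∨ ∃ p, s(src p, tgt p) = s(u, v) := by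
  classical
  obtain ⟨hne, hinj⟩ := hp
  let E := {p : {p : Sym2 C // ¬ p.IsDiag} // ∀ i a, s(ctr i, leaf i a) ≠ p.1}
  have hex : ∀ p : Sym2 C, ∃ u v, s(u, v) = p := fun p => by
    induction p using Sym2.ind with
    | _ u v => exact ⟨u, v, rfl⟩
  choose src tgt hst using hex
  let ε := (Fintype.equivFin E).symm
  refine ⟨Fintype.card E, fun p => src (ε p).1.1, fun p => tgt (ε p).1.1, ?_, ?_, ?_, ?_, ?_⟩
  · rw [← Sym2.card_subtype_not_diag]
    let g : E ⊕ ι × Fin e → {p : Sym2 C // ¬ p.IsDiag} :=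
      Sum.elim Subtype.val fun p => ⟨s(ctr p.1, leaf p.1 p.2), by simpa using hne p.1 p.2⟩
    have hg : Bijective g := by
      constructor
      · refine Subtype.val_injective.sumElim (fun p p' h => hinj (Subtype.ext_iff.1 h)) ?_
        rintro ⟨p, h⟩ ⟨i, a⟩ rfl
        exact h i a rfl
      · intro p
        by_cases h : ∀ i a, s(ctr i, leaf i a) ≠ p.1
        · exact ⟨.inl ⟨p, h⟩, rfl⟩
        · push Not at h
          obtain ⟨i, a, hia⟩ := h
          exact ⟨.inr (i, a), Subtype.ext hia⟩
    simpa using Fintype.card_of_bijective hg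
  · intro p h
    apply (ε p).1.2
    rw [← hst (ε p).1.1]
    exact h
  · intro p p' h
    simp only [hst] at h
    exact ε.injective (Subtype.ext (Subtype.ext h))
  · intro i a p
    rw [hst]
    exact (ε p).2 i a
  · intro u v huv
    by_cases h : ∀ i a, s(ctr i, leaf i a) ≠ s(u, v)
    · exact .inr ⟨ε.symm ⟨⟨s(u, v), by simpa using huv⟩, h⟩, by simp [hst]⟩
    · push Not at h
      exact .inl h

/-- The out-neighbourhood `O` of a vertex of colour `j` can be split into leaf sets of
non-monochromatic stars, including a prescribed leaf set `M i` of each colour `i ≠ j`. -/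
theorem exists_leaf_partition {V : Type} [DecidableEq V] {k e r : ℕ} (he : 1 ≤ e) (c : V → Fin k)
    (j : Fin k) (O : Finset V) (hO : O.card = (k + r) * e)
    (M : Fin k → Fin e → V) (hM : ∀ i, Injective (M i) ∧ ∀ a, M i a ∈ O ∧ c (M i a) = i)
    (hj : k + r + k * e ≤ (O.filter (c · ≠ j)).card) :
    ∃ rows : Fin k ⊕ Fin r → Fin e → V,
      (Injective fun p : (Fin k ⊕ Fin r) × Fin e => rows p.1 p.2) ∧
      (∀ v, (∃ x a, rows x a = v) ↔ v ∈ O) ∧ (∀ x, ∃ a, c (rows x a) ≠ j) ∧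
      ∀ i, i ≠ j → ∃ x, rows x = M i := by
  let a₀ : Fin e := ⟨0, he⟩
  let W := O.filter (c · ≠ j) \ Finset.univ.image fun p : Fin k × Fin e => M p.1 p.2
  have hW : Fintype.card (Fin k ⊕ Fin r) ≤ Fintype.card W := by
    have h1 := Finset.le_card_sdiff (Finset.univ.image fun p : Fin k × Fin e => M p.1 p.2)
      (O.filter (c · ≠ j))
    have h2 : (Finset.univ.image fun p : Fin k × Fin e => M p.1 p.2).card ≤ k * e :=
      Finset.card_image_le.trans (by simp)
    simp only [Fintype.card_sum, Fintype.card_fin, Fintype.card_coe, W]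
    omega
  obtain ⟨w⟩ := Function.Embedding.nonempty_of_card_le hW
  have hwO : ∀ x, (w x : V) ∈ O ∧ c (w x) ≠ j := fun x => by
    have := Finset.mem_sdiff.1 (w x).2
    simpa using this.1
  have hwM : ∀ x i a, (w x : V) ≠ M i a := fun x i a h => by
    refine (Finset.mem_sdiff.1 (w x).2).2 ?_
    rw [h]
    exact Finset.mem_image.2 ⟨(i, a), by simp, rfl⟩
  have hwinj : ∀ x y, (w x : V) = w y → x = y := fun x y h => w.injective (Subtype.ext h)
  let f : (Fin k ⊕ Fin r) × Fin e → V := fun p =>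
    Sum.elim (fun i => if i = j then w (.inl i) else M i p.2) (fun y => w (.inr y)) p.1
  let A : Finset ((Fin k ⊕ Fin r) × Fin e) :=
    Finset.univ.filter fun p => p.2 = a₀ ∨ ∃ i, i ≠ j ∧ p.1 = .inl i
  have hfO : A.image f ⊆ O := by
    intro v hv
    obtain ⟨⟨i | y, a⟩, -, rfl⟩ := Finset.mem_image.1 hv
    · by_cases h : i = j
      · simpa [f, h] using (hwO _).1
      · simpa [f, h] using ((hM i).2 a).1
    · simpa [f] using (hwO _).1
  have hfinj : Set.InjOn f A := by
    rintro ⟨x | y, a⟩ h ⟨x' | y', a'⟩ h' heq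
    · simp only [Finset.coe_filter, A, Finset.mem_univ, true_and, Set.mem_ofPred_eq, Sum.inl.injEq,
        exists_eq_right'] at h h'
      by_cases hx : x = j <;> by_cases hx' : x' = j
      · simp_all
      · simp only [f, Sum.elim_inl, hx, hx', if_true, if_false] at heq
        exact absurd heq (hwM _ _ _)
      · simp only [f, Sum.elim_inl, hx, hx', if_true, if_false] at heq
        exact absurd heq.symm (hwM _ _ _)
      · simp only [f, Sum.elim_inl, hx, hx', if_false] at heq
        obtain rfl : x = x' := by
          rw [← ((hM x).2 a).2, heq, ((hM x').2 a').2]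
        rw [(hM x).1 heq]
    · by_cases hx : x = j <;> simp only [f, Sum.elim_inl, Sum.elim_inr, hx, if_true, if_false] at heq
      · exact absurd (hwinj _ _ heq) (by simp)
      · exact absurd heq.symm (hwM _ _ _)
    · by_cases hx : x' = j <;> simp only [f, Sum.elim_inl, Sum.elim_inr, hx, if_true, if_false] at heq
      · exact absurd (hwinj _ _ heq) (by simp)
      · exact absurd heq (hwM _ _ _)
    · have := hwinj _ _ heq
      simp_all [A]
  obtain ⟨g, hg⟩ := Finset.exists_equiv_extend_of_card_eq (t := O) (by simp [hO]) hfO hfinj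
  refine ⟨fun x a => g (x, a), fun p p' h => g.injective (Subtype.ext h), fun v => ⟨?_, ?_⟩, ?_, ?_⟩
  · rintro ⟨x, a, rfl⟩
    exact (g (x, a)).2
  · intro hv
    exact ⟨(g.symm ⟨v, hv⟩).1, (g.symm ⟨v, hv⟩).2, by simp⟩
  · intro x
    refine ⟨a₀, ?_⟩
    change c (g (x, a₀)) ≠ j
    rw [hg _ (by simp [A])]
    rcases x with i | y
    · by_cases h : i = j
      · simpa [f, h] using (hwO _).2
      · simp [f, h, ((hM i).2 a₀).2]
    · simpa [f] using (hwO _).2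
  · intro i hij
    refine ⟨.inl i, funext fun a => ?_⟩
    change (g (.inl i, a) : V) = M i a
    rw [hg _ (by simp [A, hij])]
    simp [f, hij]

/-- The cyclic tournament on `Fin (2 * t + 1)`. -/
def CyclicArc (t i j : ℕ) : Prop := (i < j ∧ j ≤ i + t) ∨ j + t < i

instance (t i j : ℕ) : Decidable (CyclicArc t i j) := by unfold CyclicArc; infer_instance

theorem card_parity_Ico (b s L : ℕ) (hb : b < 2) :
    L ≤ 2 * ((Finset.Ico s (s + L)).filter (· % 2 = b)).card + 1 := by
  induction L using Nat.twoStepInduction with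
  | zero => simp
  | one => simp
  | more L ih _ =>
    have hlt : ((Finset.Ico s (s + L)).filter (· % 2 = b)).card <
        ((Finset.Ico s (s + (L + 2))).filter (· % 2 = b)).card := by
      apply Finset.card_lt_card
      refine Finset.ssubset_iff.2 ⟨if (s + L) % 2 = b then s + L else s + L + 1, ?_, ?_⟩
      · split_ifs <;> simp
      · intro x
        simp only [Finset.mem_insert, Finset.mem_filter, Finset.mem_Ico]
        split_ifs <;> omega
    omega

theorem card_filter_fin {m : ℕ} (P : ℕ → Prop) [DecidablePred P] :
    (Finset.univ.filter fun j : Fin m => P j).card = ((Finset.range m).filter P).card := by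
  rw [Finset.card_filter, Finset.card_filter, Fin.sum_univ_eq_sum_range fun j => if P j then 1 else 0]

theorem card_cyclicArc {t : ℕ} (i : Fin (2 * t + 1)) :
    (Finset.univ.filter fun j : Fin (2 * t + 1) => CyclicArc t i j).card = t := by
  have hi := i.2
  rw [card_filter_fin]
  have : (Finset.range (2 * t + 1)).filter (CyclicArc t i) =
      Finset.Ico (i + 1 : ℕ) (min (2 * t + 1) (i + t + 1)) ∪ Finset.Ico 0 (i - t : ℕ) := by
    ext x
    simp only [CyclicArc, Finset.mem_filter, Finset.mem_union, Finset.mem_Ico, Finset.mem_range]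
    omega
  rw [this, Finset.card_union_of_disjoint, Nat.card_Ico, Nat.card_Ico]
  · omega
  · rw [Finset.disjoint_left]
    intro x
    simp only [Finset.mem_Ico]
    omega

theorem card_cyclicArc_parity {t : ℕ} (i : Fin (2 * t + 1)) (b : ℕ) (hb : b < 2) :
    t ≤ 2 * (Finset.univ.filter
      fun j : Fin (2 * t + 1) => CyclicArc t i j ∧ (j : ℕ) % 2 = b).card + 2 := by
  have hi := i.2
  rw [card_filter_fin fun j => CyclicArc t i j ∧ j % 2 = b]
  have : (Finset.range (2 * t + 1)).filter (fun j => CyclicArc t i j ∧ j % 2 = b) =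
      (Finset.Ico (i + 1 : ℕ) (i + 1 + min t (2 * t - i))).filter (· % 2 = b) ∪
        (Finset.Ico 0 (0 + (i - t) : ℕ)).filter (· % 2 = b) := by
    ext x
    simp only [Finset.mem_filter, Finset.mem_union, Finset.mem_Ico, Finset.mem_range]
    unfold CyclicArc
    omega
  rw [this, Finset.card_union_of_disjoint]
  · have h1 := card_parity_Ico b (i + 1) (min t (2 * t - i)) hb
    have h2 := card_parity_Ico b 0 (i - t) hb
    omega
  · rw [Finset.disjoint_left]
    intro x
    simp only [Finset.mem_filter, Finset.mem_Ico]
    omega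

section Completion

variable {C ι D R : Type} {f q z : ℕ}

/-- The centres of the stars in a decomposition of the complete graph on `C ⊕ D` extending a
packing on `C`. -/
def completionCtr (ctr : ι → C) (src : Fin q → C) (x₀ : C) :
    (ι ⊕ Fin q) ⊕ (Fin z ⊕ D × R) → C ⊕ D :=
  Sum.elim (Sum.elim (fun i => .inl (ctr i)) fun p => .inl (src p))
    (Sum.elim (fun _ => .inl x₀) fun p => .inr p.1)

/-- The leaves of the stars in a decomposition of the complete graph on `C ⊕ D` extending a
packing on `C`. -/
def completionLeaf (leaf : ι → Fin (f + 1) → C) (tgt : Fin q → C)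
    (τ : Fin q × Fin f ⊕ Fin z × Fin (f + 1) ≃ D) (rows : D → R → Fin (f + 1) → C ⊕ D) :
    (ι ⊕ Fin q) ⊕ (Fin z ⊕ D × R) → Fin (f + 1) → C ⊕ D :=
  Sum.elim (Sum.elim (fun i a => .inl (leaf i a))
      fun p => Fin.cons (.inl (tgt p)) fun b => .inr (τ (.inl (p, b))))
    (Sum.elim (fun y a => .inr (τ (.inr (y, a)))) fun p a => rows p.1 p.2 a)

/-- The edges of `C` outside the packing are the pairs `src p`, `tgt p`; each vertex `d : D` is a
leaf of exactly one star centred in `C`, with centre `own d`, and the stars centred at `d` are given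
by `rows d`. -/
theorem isPacking_completion {ctr : ι → C} {leaf : ι → Fin (f + 1) → C}
    (hp : IsPacking ctr leaf) {src tgt : Fin q → C} (hne : ∀ p, src p ≠ tgt p)
    (hinj : Injective fun p => s(src p, tgt p))
    (hdisj : ∀ i a p, s(ctr i, leaf i a) ≠ s(src p, tgt p))
    {τ : Fin q × Fin f ⊕ Fin z × Fin (f + 1) ≃ D} {x₀ : C} {own : D → C}
    (hown : ∀ y, own (τ y) = Sum.elim (fun p => src p.1) (fun _ => x₀) y)
    {arc : D → D → Prop} (hirr : ∀ d, ¬ arc d d) (hasym : ∀ d d', arc d d' → ¬ arc d' d)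
    {rows : D → R → Fin (f + 1) → C ⊕ D}
    (hrinj : ∀ d, Injective fun p : R × Fin (f + 1) => rows d p.1 p.2)
    (hrange : ∀ d v, (∃ r a, rows d r a = v) ↔ Sum.elim (fun x => x ≠ own d) (arc d) v) :
    IsPacking (completionCtr ctr src x₀) (completionLeaf leaf tgt τ rows) := by
  have hrowl : ∀ d r a x, rows d r a = .inl x → x ≠ own d := fun d r a x h =>
    (hrange d (.inl x)).1 ⟨r, a, h⟩
  have hrowr : ∀ d r a d', rows d r a = .inr d' → arc d d' := fun d r a d' h =>
    (hrange d (.inr d')).1 ⟨r, a, h⟩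
  have hown₁ : ∀ p b, own (τ (.inl (p, b))) = src p := fun p b => hown _
  have hown₂ : ∀ y, own (τ (.inr y)) = x₀ := fun y => hown _
  constructor
  · rintro ((i | p) | (y | ⟨d, r⟩)) a
    · simpa [completionCtr, completionLeaf] using hp.1 i a
    · refine Fin.cases ?_ (fun b => ?_) a
      · simpa [completionCtr, completionLeaf] using hne p
      · simp [completionCtr, completionLeaf]
    · simp [completionCtr, completionLeaf]
    · intro h
      exact hirr d (hrowr d r a d h.symm)
  · have hrow : ∀ d r a x d', s(Sum.inr d, rows d r a) = s(.inl x, .inr d') → x ≠ own d' := by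
      intro d r a x d' h
      simp only [Sym2.eq_iff, reduceCtorEq, false_and, Sum.inr.injEq, false_or] at h
      rw [← h.1]
      exact hrowl d r a x h.2
    have hmix : ∀ (x x' y : C) (d : D),
        (s(Sum.inl x, Sum.inl x') : Sym2 (C ⊕ D)) ≠ s(.inl y, .inr d) := by simp
    have hmix' : ∀ (x x' : C) (d : D) v,
        (s(Sum.inl x, Sum.inl x') : Sym2 (C ⊕ D)) ≠ s(.inr d, v) := by simp
    have hll : ∀ x x' y y' : C,
        (s(Sum.inl x, Sum.inl x') : Sym2 (C ⊕ D)) = s(.inl y, .inl y') → s(x, x') = s(y, y') := by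
      simp
    have hlr : ∀ (x y : C) (d d' : D),
        (s(Sum.inl x, Sum.inr d) : Sym2 (C ⊕ D)) = s(.inl y, .inr d') → d = d' := by
      simp
    rintro ⟨(i | p) | (y | ⟨d, r⟩), a⟩ ⟨(i' | p') | (y' | ⟨d', r'⟩), a'⟩ h
    · obtain ⟨rfl, rfl⟩ := Prod.mk.inj (@hp.2 (i, a) (i', a') (hll _ _ _ _ h))
      rfl
    · cases a' using Fin.cases with
      | zero => exact absurd (hll _ _ _ _ h) (hdisj _ _ _)
      | succ b' => exact absurd h (hmix _ _ _ _)
    · exact absurd h (hmix _ _ _ _)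
    · exact absurd h (hmix' _ _ _ _)
    · cases a using Fin.cases with
      | zero => exact absurd (hll _ _ _ _ h).symm (hdisj _ _ _)
      | succ b => exact absurd h.symm (hmix _ _ _ _)
    · cases a using Fin.cases with
      | zero =>
        cases a' using Fin.cases with
        | zero => rw [hinj (hll _ _ _ _ h)]
        | succ b' => exact absurd h (hmix _ _ _ _)
      | succ b =>
        cases a' using Fin.cases with
        | zero => exact absurd h.symm (hmix _ _ _ _)
        | succ b' =>
          have hpb : (p, b) = (p', b') := Sum.inl_injective (τ.injective (hlr _ _ _ _ h))
          rw [(Prod.mk.inj hpb).1, (Prod.mk.inj hpb).2]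
    · cases a using Fin.cases with
      | zero => exact absurd h (hmix _ _ _ _)
      | succ b => exact absurd (τ.injective (hlr _ _ _ _ h)) (by simp)
    · cases a using Fin.cases with
      | zero => exact absurd h (hmix' _ _ _ _)
      | succ b => exact absurd (hown₁ _ _).symm (hrow _ _ _ _ _ h.symm)
    · exact absurd h.symm (hmix _ _ _ _)
    · cases a' using Fin.cases with
      | zero => exact absurd h.symm (hmix _ _ _ _)
      | succ b => exact absurd (τ.injective (hlr _ _ _ _ h)) (by simp)
    · obtain ⟨rfl, rfl⟩ := Prod.mk.inj (Sum.inr_injective (τ.injective (hlr _ _ _ _ h)))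
      rfl
    · exact absurd (hown₂ _).symm (hrow _ _ _ _ _ h.symm)
    · exact absurd h.symm (hmix' _ _ _ _)
    · cases a' using Fin.cases with
      | zero => exact absurd h.symm (hmix' _ _ _ _)
      | succ b => exact absurd (hown₁ _ _).symm (hrow _ _ _ _ _ h)
    · exact absurd (hown₂ _).symm (hrow _ _ _ _ _ h)
    · rcases Sym2.eq_iff.1 h with ⟨h₁, h₂⟩ | ⟨h₁, h₂⟩
      · obtain rfl := Sum.inr_injective h₁
        obtain ⟨rfl, rfl⟩ := Prod.mk.inj (@hrinj d (r, a) (r', a') h₂)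
        rfl
      · exact absurd (hrowr _ _ _ _ h₁.symm) (hasym _ _ (hrowr _ _ _ _ h₂))

theorem completion_covers {ctr : ι → C} {leaf : ι → Fin (f + 1) → C} {src tgt : Fin q → C}
    (hcov : ∀ u v, u ≠ v →
      (∃ i a, s(ctr i, leaf i a) = s(u, v)) ∨ ∃ p, s(src p, tgt p) = s(u, v))
    {τ : Fin q × Fin f ⊕ Fin z × Fin (f + 1) ≃ D} {x₀ : C} {own : D → C}
    (hown : ∀ y, own (τ y) = Sum.elim (fun p => src p.1) (fun _ => x₀) y)
    {arc : D → D → Prop} (htot : ∀ d d', d ≠ d' → arc d d' ∨ arc d' d)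
    {rows : D → R → Fin (f + 1) → C ⊕ D}
    (hrange : ∀ d v, (∃ r a, rows d r a = v) ↔ Sum.elim (fun x => x ≠ own d) (arc d) v)
    (u v : C ⊕ D) (huv : u ≠ v) :
    ∃ i a, s(completionCtr ctr src x₀ i, completionLeaf leaf tgt τ rows i a) = s(u, v) := by
  have hmixed : ∀ x d, ∃ i a,
      s(completionCtr ctr src x₀ i, completionLeaf leaf tgt τ rows i a) = s(.inl x, .inr d) := by
    intro x d
    by_cases hx : x = own d
    · obtain ⟨y, rfl⟩ := τ.surjective d
      rw [hown] at hx
      rcases y with ⟨p, b⟩ | ⟨y, a⟩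
      · exact ⟨.inl (.inr p), b.succ, by simp [completionCtr, completionLeaf, hx]⟩
      · exact ⟨.inr (.inl y), a, by simp [completionCtr, completionLeaf, hx]⟩
    · obtain ⟨r, a, h⟩ := (hrange d (.inl x)).2 hx
      exact ⟨.inr (.inr (d, r)), a, by simp [completionCtr, completionLeaf, h]⟩
  rcases u with x | d <;> rcases v with x' | d'
  · rcases hcov x x' (by simpa using huv) with ⟨i, a, h⟩ | ⟨p, h⟩
    · exact ⟨.inl (.inl i), a, by simpa [completionCtr, completionLeaf] using h⟩
    · exact ⟨.inl (.inr p), 0, by simpa [completionCtr, completionLeaf] using h⟩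
  · exact hmixed x d'
  · rw [Sym2.eq_swap]
    exact hmixed x' d
  · rcases htot d d' (by simpa using huv) with h | h
    · obtain ⟨r, a, h⟩ := (hrange d (.inr d')).2 h
      exact ⟨.inr (.inr (d, r)), a, by simp [completionCtr, completionLeaf, h]⟩
    · obtain ⟨r, a, h⟩ := (hrange d' (.inr d)).2 h
      exact ⟨.inr (.inr (d', r)), a, by simp [completionCtr, completionLeaf, h]⟩

end Completion

theorem chromatic_and_uniquelyColourable {n e k : ℕ} (hk : 1 ≤ k) (sys : EStarSystem n e)
    (c₀ : Fin n → Fin k) (hc₀ : IsWeakColouring sys c₀) (hsurj : Surjective c₀)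
    (huniq : ∀ c : Fin n → Fin k, IsWeakColouring sys c → ∃ π : Equiv.Perm (Fin k), c = π ∘ c₀) :
    Chromatic sys k ∧ UniquelyColourable sys k := by
  refine ⟨⟨⟨c₀, hc₀⟩, ?_⟩, ?_⟩
  · rintro ⟨c, hc⟩
    have hle : k - 1 ≤ k := Nat.sub_le k 1
    obtain ⟨π, hπ⟩ := huniq (Fin.castLE hle ∘ c) fun S hS => by
      obtain ⟨a, ha, hac⟩ := hc S hS
      exact ⟨a, ha, fun h => hac (Fin.castLE_injective hle h)⟩
    have hs : Surjective (Fin.castLE hle) := Surjective.of_comp (g := c) <| by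
      rw [hπ]
      exact π.surjective.comp hsurj
    have := Fintype.card_le_of_surjective _ hs
    simp only [Fintype.card_fin] at this
    omega
  · intro c₁ c₂ h₁ h₂
    obtain ⟨π₁, rfl⟩ := huniq c₁ h₁
    obtain ⟨π₂, rfl⟩ := huniq c₂ h₂
    refine ⟨π₁.symm.trans π₂, ?_⟩
    ext v
    simp

/-- A uniquely colourable packing on `C` extends to a uniquely chromatic star system on
`C ⊕ Fin (2 * t + 1)` when `t` is large and satisfies the divisibility conditions. -/
theorem exists_system_extending {C ι : Type} [Fintype C] [Fintype ι] {k f q z r t n : ℕ}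
    (hk : 2 ≤ k) (hf : 2 ≤ f) {ctr : ι → C} {leaf : ι → Fin (f + 1) → C} {c₀ : C → Fin k}
    {emb : Fin k → Fin (f + 1 + 1) → C} (hp : IsPacking ctr leaf) (hc₀ : IsProper ctr leaf c₀)
    (huniq : ∀ c : C → Fin k, IsProper ctr leaf c → ∃ π : Equiv.Perm (Fin k), c = π ∘ c₀)
    (hemb : ∀ i, Injective (emb i)) (hembc : ∀ i a, c₀ (emb i a) = i)
    {src tgt : Fin q → C} (hne : ∀ p, src p ≠ tgt p)
    (hinj : Injective fun p => s(src p, tgt p))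
    (hdisj : ∀ i a p, s(ctr i, leaf i a) ≠ s(src p, tgt p))
    (hcov : ∀ u v, u ≠ v →
      (∃ i a, s(ctr i, leaf i a) = s(u, v)) ∨ ∃ p, s(src p, tgt p) = s(u, v))
    (hn : Fintype.card C + (2 * t + 1) = n) (hz : q * f + z * (f + 1) = 2 * t + 1)
    (hr : Fintype.card C + t = (k + r) * (f + 1) + 1)
    (ht : 2 * Fintype.card C + 6 * (k * (f + 1)) + 12 ≤ t) :
    ∃ sys : EStarSystem n (f + 1), Chromatic sys k ∧ UniquelyColourable sys k := by
  classical
  let D := Fin (2 * t + 1)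
  let κ₀ : Fin k := ⟨0, by omega⟩
  let κ₁ : Fin k := ⟨1, by omega⟩
  have hκ : κ₀ ≠ κ₁ := by simp [κ₀, κ₁]
  let x₀ : C := emb κ₀ 0
  let τ : Fin q × Fin f ⊕ Fin z × Fin (f + 1) ≃ D :=
    (Equiv.sumCongr finProdFinEquiv finProdFinEquiv).trans (finSumFinEquiv.trans (finCongr hz))
  have hτ₁ : ∀ p b, (τ (.inl (p, b)) : ℕ) = b + f * p := fun p b => rfl
  have hτ₂ : ∀ y a, (τ (.inr (y, a)) : ℕ) = q * f + (a + (f + 1) * y) := fun y a => rfl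
  let own : D → C := fun d => Sum.elim (fun p => src p.1) (fun _ => x₀) (τ.symm d)
  have hown : ∀ y, own (τ y) = Sum.elim (fun p => src p.1) (fun _ => x₀) y := fun y => by
    simp [own]
  let arc : D → D → Prop := fun d d' => CyclicArc t d d'
  let cD : D → Fin k := fun d => if (d : ℕ) % 2 = 0 then κ₀ else κ₁
  have hcD : ∀ d d' : D, (d' : ℕ) = d + 1 → cD d ≠ cD d' := fun d d' h => by
    simp only [cD]
    split_ifs with h₁ h₂ h₂
    · omega
    · exact hκ
    · exact hκ.symm
    · omega
  let c' : C ⊕ D → Fin k := Sum.elim c₀ cD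
  let O : D → Finset (C ⊕ D) := fun d =>
    (Finset.univ.erase (own d)).disjSum (Finset.univ.filter (arc d))
  have hOcard : ∀ d, (O d).card = (k + r) * (f + 1) := fun d => by
    have h1 : (Finset.univ.filter (arc d)).card = t := card_cyclicArc d
    rw [Finset.card_disjSum, h1, Finset.card_erase_of_mem (Finset.mem_univ _), Finset.card_univ]
    have : 0 < Fintype.card C := Fintype.card_pos_iff.2 ⟨x₀⟩
    omega
  have hb : ∀ d i, ∃ b : Fin (f + 1 + 1), ∀ a, emb i (b.succAbove a) ≠ own d := by
    intro d i
    by_cases h : ∃ b, emb i b = own d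
    · obtain ⟨b, hb⟩ := h
      exact ⟨b, fun a ha => Fin.succAbove_ne b a (hemb i (ha.trans hb.symm))⟩
    · push Not at h
      exact ⟨0, fun a => h _⟩
  choose b hb using hb
  let M : D → Fin k → Fin (f + 1) → C ⊕ D := fun d i a => .inl (emb i ((b d i).succAbove a))
  have hM : ∀ d i, Injective (M d i) ∧ ∀ a, M d i a ∈ O d ∧ c' (M d i a) = i := fun d i =>
    ⟨fun a a' h => Fin.succAbove_right_injective (hemb i (Sum.inl_injective h)), fun a =>
      ⟨by simp [M, O, hb d i a], by simp [M, c', hembc]⟩⟩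
  have hOj : ∀ d, k + r + k * (f + 1) ≤ ((O d).filter (c' · ≠ cD d)).card := by
    intro d
    let S : Finset D := Finset.univ.filter fun j : Fin (2 * t + 1) =>
      CyclicArc t d j ∧ (j : ℕ) % 2 = 1 - (d : ℕ) % 2
    have h1 : t ≤ 2 * S.card + 2 := card_cyclicArc_parity d (1 - (d : ℕ) % 2) (by omega)
    have h2 : S.card ≤ ((O d).filter (c' · ≠ cD d)).card := by
      refine Finset.card_le_card_of_injOn Sum.inr ?_ Sum.inr_injective.injOn
      intro j hj
      obtain ⟨hj, hj'⟩ := (Finset.mem_filter.1 hj).2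
      refine Finset.mem_filter.2 ⟨by simpa [O] using hj, ?_⟩
      simp only [c', Sum.elim_inr, cD]
      split_ifs with h₁ h₂ h₂
      · omega
      · exact hκ
      · exact hκ.symm
      · omega
    have h3 : (k + r) * 3 ≤ (k + r) * (f + 1) := Nat.mul_le_mul_left _ (by omega)
    omega
  have hrows := fun d => exists_leaf_partition (by omega) c' (cD d) (O d) (hOcard d)
    (M d) (hM d) (hOj d)
  choose rows hrinj hrO hrne hrmono using hrows
  have hrange : ∀ d v, (∃ x a, rows d x a = v) ↔ Sum.elim (fun x => x ≠ own d) (arc d) v := by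
    intro d v
    rw [hrO]
    rcases v with x | d' <;> simp [O]
  have hpack := isPacking_completion hp hne hinj hdisj hown (arc := arc)
    (fun d => by simp [arc, CyclicArc])
    (fun d d' => by simp only [arc, CyclicArc]; omega) hrinj hrange
  have hcover := completion_covers hcov hown (arc := arc)
    (fun d d' h => by
      have h' : (d : ℕ) ≠ d' := fun h' => h (Fin.ext h')
      have := d.2
      have := d'.2
      simp only [arc, CyclicArc]
      omega) hrange
  let ψ : C ⊕ D ≃ Fin n := Fintype.equivFinOfCardEq (by simpa [D] using hn)
  obtain ⟨sys, hsys⟩ := exists_system_of_packing ψ hpack hcover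
  have hψ : (c' ∘ ψ.symm) ∘ ψ = c' := by
    ext v
    simp
  have hpick : ∀ (x : Fin k) (d d' : D), (d' : ℕ) = d + 1 → cD d ≠ x ∨ cD d' ≠ x := by
    intro x d d' h
    by_contra! hx
    exact hcD d d' h (hx.1.trans hx.2.symm)
  refine ⟨sys, chromatic_and_uniquelyColourable (by omega) sys (c' ∘ ψ.symm) ?_ ?_ ?_⟩
  · rw [hsys, hψ]
    rintro ((i | p) | (y | ⟨d, x⟩))
    · exact hc₀ i
    · rcases hpick (c₀ (src p)) (τ (.inl (p, ⟨0, by omega⟩))) (τ (.inl (p, ⟨1, by omega⟩)))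
        (by simp only [hτ₁]; omega) with h | h
      · exact ⟨Fin.succ ⟨0, by omega⟩, h⟩
      · exact ⟨Fin.succ ⟨1, by omega⟩, h⟩
    · rcases hpick (c₀ x₀) (τ (.inr (y, ⟨0, by omega⟩))) (τ (.inr (y, ⟨1, by omega⟩)))
        (by simp only [hτ₂]; omega) with h | h
      · exact ⟨⟨0, by omega⟩, h⟩
      · exact ⟨⟨1, by omega⟩, h⟩
    · exact hrne d x
  · exact fun i => ⟨ψ (.inl (emb i 0)), by simp [c', hembc]⟩
  · intro c hc
    rw [hsys] at hc
    obtain ⟨π, hπ⟩ := huniq (fun x => c (ψ (.inl x))) fun i => hc (.inl (.inl i))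
    have hC : ∀ x, c (ψ (.inl x)) = π (c₀ x) := congrFun hπ
    refine ⟨π, funext fun v => ?_⟩
    obtain ⟨x | d, rfl⟩ := ψ.surjective v
    · simpa [c'] using hC x
    · have hforce : ∀ i, i ≠ cD d → π i ≠ c (ψ (.inr d)) := by
        intro i hi
        obtain ⟨x, hx⟩ := hrmono d i hi
        obtain ⟨a, ha⟩ := hc (.inr (.inr (d, x)))
        have ha' : c (ψ (rows d x a)) ≠ c (ψ (.inr d)) := ha
        rwa [hx, hC, hembc] at ha'
      by_contra hne
      refine hforce (π.symm (c (ψ (.inr d)))) (fun h => hne ?_) (π.apply_symm_apply _)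
      simp [c', ← h]

/-- Uniquely `k`-chromatic star systems exist for all large orders in a fixed admissible residue
class modulo `2 * e`. -/
theorem exists_system_of_residue {k f : ℕ} (hk : 2 ≤ k) (hf : 2 ≤ f) {δ : ℕ} (hδ : δ ≤ 1) :
    ∃ h₀ : ℕ, ∀ h, h₀ ≤ h → ∃ sys : EStarSystem (2 * (f + 1) * h + δ) (f + 1),
      Chromatic sys k ∧ UniquelyColourable sys k := by
  obtain ⟨g, hg⟩ := exists_uniquely_colourable_packing (e := f + 1) (k := k) (by omega) (by omega)
  obtain ⟨C, ι, _, _, ctr, leaf, c₀, emb, hcard, hp, hc₀, huniq, hemb, hembc⟩ :=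
    hg (2 * (f + 1) * g + (3 - δ)) (by nlinarith)
  obtain ⟨q, src, tgt, hq, hne, hinj, hdisj, hcov⟩ := exists_enum_uncovered hp
  refine ⟨g + (2 * Fintype.card C + 6 * (k * (f + 1)) + 14 + q * f + k), fun h hh => ?_⟩
  obtain ⟨y, rfl⟩ := Nat.exists_eq_add_of_le (show g ≤ h by omega)
  have hy : 2 * Fintype.card C + 6 * (k * (f + 1)) + 14 + q * f + k ≤ y := by omega
  have hfy : y ≤ (f + 1) * y := by nlinarith
  obtain ⟨t, ht⟩ : ∃ t, (f + 1) * y + δ = t + 2 := ⟨(f + 1) * y + δ - 2, by omega⟩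
  obtain ⟨r, hr⟩ : ∃ r, 2 * g + y = k + r := ⟨2 * g + y - k, by omega⟩
  have hdvd : ((f + 1 : ℕ) : ℤ) ∣ ((2 * t + 1 - q * f : ℕ) : ℤ) := by
    rw [hcard] at hq
    rw [Nat.cast_sub (by omega)]
    have hch : (((2 * (f + 1) * g + (3 - δ)).choose 2 : ℕ) : ℤ) =
        (2 * (f + 1) * g + 3 - 2 * δ) * ((f + 1) * g + 1) := by
      rw [Nat.choose_two_right]
      interval_cases δ
      · rw [Nat.div_eq_of_eq_mul_left (k := (2 * (f + 1) * g + 3) * ((f + 1) * g + 1)) two_pos]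
        · push_cast
          ring
        · simp only [Nat.sub_zero, Nat.add_succ_sub_one]
          ring
      · rw [Nat.div_eq_of_eq_mul_left (k := (2 * (f + 1) * g + 1) * ((f + 1) * g + 1)) two_pos]
        · push_cast
          ring
        · simp only [Nat.reduceSub, Nat.add_succ_sub_one]
          ring
    rw [← hq] at hch
    have ht' : ((f : ℤ) + 1) * y + δ = t + 2 := by exact_mod_cast ht
    push_cast at hch ⊢
    have ht'' : (t : ℤ) = (f + 1) * y + δ - 2 := by linarith
    have hq' : (q : ℤ) = (2 * (f + 1) * g + 3 - 2 * δ) * ((f + 1) * g + 1)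
        - Fintype.card ι * (f + 1) := by linarith
    refine ⟨2 * y + (2 * (f + 1) * g + 3 - 2 * δ) * g + 2 * g - Fintype.card ι - q, ?_⟩
    have : (2 * (t : ℤ) + 1 - q * f) = 2 * t + 1 + q - (f + 1) * q := by ring
    rw [this]
    nth_rewrite 1 [hq']
    rw [ht'']
    ring
  obtain ⟨z, hz⟩ := Int.natCast_dvd_natCast.1 hdvd
  refine exists_system_extending (t := t) (r := r) (z := z) hk hf hp hc₀ huniq hemb hembc hne hinj
    hdisj hcov ?_ ?_ ?_ ?_
  · have : 2 * (f + 1) * (g + y) = 2 * (f + 1) * g + 2 * ((f + 1) * y) := by ring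
    rw [hcard, this]
    omega
  · rw [mul_comm z, ← hz]
    omega
  · rw [hcard, ← hr, add_mul]
    have h1 : 2 * (f + 1) * g = 2 * g * (f + 1) := by ring
    have h2 : (f + 1) * y = y * (f + 1) := by ring
    omega
  · omega

/-- For all `k ≥ 2` and `e ≥ 3` there is `n₀ ≡ 0 (mod 2e)` such that uniquely
`k`-chromatic `e`-star systems exist for all orders `n ≥ n₀` with `n ≡ 0,1 (mod 2e)`. -/
theorem stmt18 (k e : ℕ) (hk : 2 ≤ k) (he : 3 ≤ e) :
    ∃ n₀ : ℕ, n₀ % (2 * e) = 0 ∧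
      ∀ n : ℕ, n₀ ≤ n → (n % (2 * e) = 0 ∨ n % (2 * e) = 1) →
        ∃ sys : EStarSystem n e, Chromatic sys k ∧ UniquelyColourable sys k := by
  obtain ⟨f, rfl⟩ : ∃ f, e = f + 1 := ⟨e - 1, by omega⟩
  obtain ⟨h₀, H₀⟩ := exists_system_of_residue hk (f := f) (by omega) (δ := 0) (by omega)
  obtain ⟨h₁, H₁⟩ := exists_system_of_residue hk (f := f) (by omega) (δ := 1) (by omega)
  refine ⟨2 * (f + 1) * (h₀ + h₁), Nat.mul_mod_right _ _, fun n hn hmod => ?_⟩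
  have hdiv : h₀ + h₁ ≤ n / (2 * (f + 1)) :=
    (Nat.le_div_iff_mul_le (by omega)).2 (by rwa [mul_comm])
  have hnd := Nat.div_add_mod n (2 * (f + 1))
  rcases hmod with h | h <;> rw [h] at hnd <;> rw [← hnd]
  · exact H₀ _ (by omega)
  · exact H₁ _ (by omega)
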